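/- Let k be an algebraically closed field of characteristic 0 and let I₄ ⊆ k[q_λ : λ ∈ E(4)] be the principal ideal generated by g = q_∅ q_{0123} − q_{01} q_{23} + q_{02} q_{13} − q_{03} q_{12}. For every weight vector w : E(4) → ℝ such that the extension of the initial ideal in_w(I₄) to the Laurent polynomial ring k[q_λ^{±1} : λ ∈ E(4)] is a proper ideal, the quotient R = k[q_λ^{±1} : λ ∈ E(4)] / in_w(I₄)·k[q_λ^{±1}] is a smooth k-algebra (formally smooth and of finite presentation over k) and the prime spectrum of R is an irreducible topological space. (Equivalently: every initial degeneration of the open cell 𝕊₄° of the spinor variety 𝕊₄ is smooth and irreducible.) -/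

import Mathlib

open Finset MvPolynomial
open scoped Classical

/-- `E(4)`: the subsets of `{0,1,2,3}` of even cardinality. -/
def E4 : Type := {l : Finset (Fin 4) // Even l.card}

instance : Fintype E4 := Subtype.fintype _

/-- The `w`-weight of a monomial `∏ q_λ^{a_λ}`, namely `Σ a_λ · w(λ)`. -/
noncomputable def monWeight {σ : Type} (w : σ → ℝ) (d : σ →₀ ℕ) : ℝ :=
  d.sum fun l a => (a : ℝ) * w l

/-- The `w`-initial form of a polynomial: the sum of its terms of minimal `w`-weight. -/
noncomputable def initialForm {σ : Type} {k : Type} [Field k] (w : σ → ℝ)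
    (f : MvPolynomial σ k) : MvPolynomial σ k :=
  ∑ d ∈ f.support.filter (fun d => ∀ e ∈ f.support, monWeight w d ≤ monWeight w e),
    monomial d (f.coeff d)

/-- The `w`-initial ideal: the ideal generated by the initial forms of the nonzero
elements of `I`. -/
noncomputable def initialIdeal {σ : Type} {k : Type} [Field k] (w : σ → ℝ)
    (I : Ideal (MvPolynomial σ k)) : Ideal (MvPolynomial σ k) :=
  Ideal.span {g | ∃ f ∈ I, f ≠ 0 ∧ g = initialForm w f}

/-- The quadric `g = q_∅ q_{0123} − q_{01} q_{23} + q_{02} q_{13} − q_{03} q_{12}`. -/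
noncomputable def spinorQuartic (k : Type) [Field k] : MvPolynomial E4 k :=
  X ⟨∅, by decide⟩ * X ⟨{0, 1, 2, 3}, by decide⟩ -
    X ⟨{0, 1}, by decide⟩ * X ⟨{2, 3}, by decide⟩ +
    X ⟨{0, 2}, by decide⟩ * X ⟨{1, 3}, by decide⟩ -
    X ⟨{0, 3}, by decide⟩ * X ⟨{1, 2}, by decide⟩

/-- The defining ideal `I₄` of the spinor variety `𝕊₄` in its Wick embedding. -/
noncomputable def I4 (k : Type) [Field k] : Ideal (MvPolynomial E4 k) :=
  Ideal.span {spinorQuartic k}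

/-- The Laurent polynomial ring `k[q_λ^{±1} : λ ∈ E(4)]`. -/
abbrev Laurent4 (k : Type) [Field k] : Type := AddMonoidAlgebra k (E4 →₀ ℤ)

/-- The canonical map from the polynomial ring to the Laurent polynomial ring. -/
noncomputable def toLaurent4 (k : Type) [Field k] :
    MvPolynomial E4 k →+* Laurent4 k :=
  (MvPolynomial.aeval fun l : E4 =>
    AddMonoidAlgebra.of' k (E4 →₀ ℤ) (Finsupp.single l 1)).toRingHom

section InitialForm

variable {σ : Type} {k : Type} [Field k] (w : σ → ℝ)

theorem monWeight_add (d e : σ →₀ ℕ) : monWeight w (d + e) = monWeight w d + monWeight w e :=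
  Finsupp.sum_add_index' (by simp) fun _ _ _ => by push_cast; ring

theorem coeff_initialForm (f : MvPolynomial σ k) (d : σ →₀ ℕ) :
    (initialForm w f).coeff d =
      if d ∈ f.support ∧ ∀ e ∈ f.support, monWeight w d ≤ monWeight w e then f.coeff d else 0 := by
  simp only [initialForm, coeff_sum, coeff_monomial, Finset.sum_ite_eq', Finset.mem_filter]

/-- A polynomial all of whose terms of minimal weight have been collected in `p` has initial
form `p`. -/
theorem initialForm_add {p q : MvPolynomial σ k} {m : ℝ} (hp : p ≠ 0)
    (hpm : ∀ d ∈ p.support, monWeight w d = m) (hqm : ∀ d ∈ q.support, m < monWeight w d) :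
    initialForm w (p + q) = p := by
  have hdisj : ∀ d ∈ p.support, q.coeff d = 0 := fun d hd => by
    by_contra h
    exact (hqm d (mem_support_iff.2 h)).ne' (hpm d hd)
  obtain ⟨e₀, he₀⟩ := support_nonempty.2 hp
  have hmem : ∀ d ∈ p.support, d ∈ (p + q).support := fun d hd => by
    rw [mem_support_iff, coeff_add, hdisj d hd, add_zero]
    exact mem_support_iff.1 hd
  ext d
  rw [coeff_initialForm]
  by_cases hd : d ∈ p.support
  · have hle : ∀ e ∈ (p + q).support, monWeight w d ≤ monWeight w e := fun e he => by
      rw [hpm d hd]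
      rcases Finset.mem_union.1 (support_add he) with h | h
      · exact (hpm e h).ge
      · exact (hqm e h).le
    rw [if_pos ⟨hmem d hd, hle⟩, coeff_add, hdisj d hd, add_zero]
  · rw [notMem_support_iff.1 hd, if_neg]
    rintro ⟨h, hle⟩
    have := hqm d ((Finset.mem_union.1 (support_add h)).resolve_left hd)
    linarith [hle e₀ (hmem e₀ he₀), hpm e₀ he₀]

theorem exists_eq_initialForm_add {f : MvPolynomial σ k} (hf : f ≠ 0) :
    ∃ (m : ℝ) (q : MvPolynomial σ k), f = initialForm w f + q ∧ initialForm w f ≠ 0 ∧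
      (∀ d ∈ (initialForm w f).support, monWeight w d = m) ∧
      ∀ d ∈ q.support, m < monWeight w d := by
  obtain ⟨e₀, he₀, hmin⟩ := Finset.exists_min_image _ (monWeight w) (support_nonempty.2 hf)
  refine ⟨monWeight w e₀, f - initialForm w f, by ring, ?_, ?_, ?_⟩
  · intro h
    have := congrArg (coeff e₀) h
    rw [coeff_initialForm, if_pos ⟨he₀, hmin⟩] at this
    exact mem_support_iff.1 he₀ this
  · intro d hd
    rw [mem_support_iff, coeff_initialForm] at hd
    have h := (ite_ne_right_iff.1 hd).1
    exact le_antisymm (h.2 e₀ he₀) (hmin d h.1)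
  · intro d hd
    rw [mem_support_iff, coeff_sub, coeff_initialForm] at hd
    by_contra! hle
    by_cases hdf : d ∈ f.support
    · exact hd (by rw [if_pos ⟨hdf, fun e he => hle.trans (hmin e he)⟩, sub_self])
    · exact hd (by rw [if_neg fun h => hdf h.1, notMem_support_iff.1 hdf, sub_zero])

theorem initialForm_mul {f g : MvPolynomial σ k} (hf : f ≠ 0) (hg : g ≠ 0) :
    initialForm w (f * g) = initialForm w f * initialForm w g := by
  obtain ⟨m, p, hfp, hf0, hfm, hpm⟩ := exists_eq_initialForm_add w hf
  obtain ⟨n, q, hgq, hg0, hgn, hqn⟩ := exists_eq_initialForm_add w hg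
  have hfg : f * g = initialForm w f * initialForm w g +
      (initialForm w f * q + p * g) := by
    linear_combination g * hfp + initialForm w f * hgq
  have hgn' : ∀ d ∈ g.support, n ≤ monWeight w d := fun d hd => by
    rw [hgq] at hd
    rcases Finset.mem_union.1 (support_add hd) with h | h
    · exact (hgn d h).ge
    · exact (hqn d h).le
  have key : ∀ (a b : MvPolynomial σ k), ∀ d ∈ (a * b).support,
      ∃ i ∈ a.support, ∃ j ∈ b.support, monWeight w d = monWeight w i + monWeight w j := by
    intro a b d hd
    obtain ⟨i, hi, j, hj, rfl⟩ := Finset.mem_add.1 (support_mul a b hd)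
    exact ⟨i, hi, j, hj, monWeight_add w i j⟩
  rw [hfg]
  refine initialForm_add w (m := m + n) (mul_ne_zero hf0 hg0) ?_ ?_
  · intro d hd
    obtain ⟨i, hi, j, hj, h⟩ := key _ _ d hd
    rw [h, hfm i hi, hgn j hj]
  · intro d hd
    rcases Finset.mem_union.1 (support_add hd) with hd | hd
    · obtain ⟨i, hi, j, hj, h⟩ := key _ _ d hd
      linarith [hfm i hi, hqn j hj]
    · obtain ⟨i, hi, j, hj, h⟩ := key _ _ d hd
      linarith [hpm i hi, hgn' j hj]

/-- The initial ideal of a principal ideal is generated by the initial form of a generator. -/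
theorem initialIdeal_span_singleton {g : MvPolynomial σ k} (hg : g ≠ 0) :
    initialIdeal w (Ideal.span {g}) = Ideal.span {initialForm w g} := by
  refine le_antisymm (Ideal.span_le.2 ?_) (Ideal.span_mono ?_)
  · rintro _ ⟨f, hf, hf0, rfl⟩
    obtain ⟨h, rfl⟩ := Ideal.mem_span_singleton'.1 hf
    rw [initialForm_mul w (left_ne_zero_of_mul hf0) hg]
    exact Ideal.mul_mem_left _ _ (Ideal.mem_span_singleton_self _)
  · rintro _ rfl
    exact ⟨g, Ideal.mem_span_singleton_self g, hg, rfl⟩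

end InitialForm

section Laurent

variable {σ : Type} {k : Type} [Field k]

/-- The Laurent polynomial associated with a polynomial. -/
noncomputable def toLaurent (σ k : Type) [Field k] :
    MvPolynomial σ k →ₐ[k] AddMonoidAlgebra k (σ →₀ ℤ) :=
  aeval fun l => AddMonoidAlgebra.of' k (σ →₀ ℤ) (Finsupp.single l 1)

theorem isUnit_toLaurent_X (l : σ) : IsUnit (toLaurent σ k (X l)) := by
  rw [toLaurent, aeval_X]
  refine IsUnit.of_mul_eq_one (AddMonoidAlgebra.of' k (σ →₀ ℤ) (Finsupp.single l (-1))) ?_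
  simp [AddMonoidAlgebra.of'_apply, AddMonoidAlgebra.single_mul_single, AddMonoidAlgebra.one_def]

/-- Evaluation of Laurent polynomials at a family of units. -/
noncomputable def laurentEval {A : Type} [CommRing A] [Algebra k A] (u : σ → Aˣ) :
    AddMonoidAlgebra k (σ →₀ ℤ) →ₐ[k] A :=
  AddMonoidAlgebra.lift k A (σ →₀ ℤ) <| (Units.coeHom A).comp <|
    AddMonoidHom.toMultiplicativeLeft <| Finsupp.liftAddHom fun l =>
      zmultiplesHom (Additive Aˣ) (Additive.ofMul (u l))

theorem laurentEval_toLaurent {A : Type} [CommRing A] [Algebra k A] (u : σ → Aˣ)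
    (f : MvPolynomial σ k) :
    laurentEval u (toLaurent σ k f) = aeval (fun l => (u l : A)) f := by
  suffices (laurentEval u).comp (toLaurent σ k) = aeval (fun l => (u l : A)) from
    DFunLike.congr_fun this f
  ext l
  simp [laurentEval, toLaurent, AddMonoidAlgebra.of'_apply]

theorem laurent_algHom_ext {A : Type} [CommRing A] [Algebra k A]
    {φ ψ : AddMonoidAlgebra k (σ →₀ ℤ) →ₐ[k] A}
    (h : ∀ l, φ (toLaurent σ k (X l)) = ψ (toLaurent σ k (X l))) : φ = ψ := by
  let F (χ : AddMonoidAlgebra k (σ →₀ ℤ) →ₐ[k] A) : (σ →₀ ℤ) →+ Additive Aˣ :=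
    MonoidHom.toAdditiveRight
      ((χ : AddMonoidAlgebra k (σ →₀ ℤ) →* A).comp (AddMonoidAlgebra.of k (σ →₀ ℤ))).toHomUnits
  have hF : F φ = F ψ := by
    ext l
    simpa [F, toLaurent, AddMonoidAlgebra.of'_apply] using h l
  refine AddMonoidAlgebra.algHom_ext (fun d => ?_) (Subsingleton.elim _ _)
  exact congrArg (fun v : Additive Aˣ => (v.toMul : A)) (DFunLike.congr_fun hF d)

variable [Fintype σ]

/-- A hypersurface in the torus whose equation is linear in the variable `x`, with a monomial
leading coefficient, is a principal open subset of the affine space in the other variables. -/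
theorem exists_algEquiv_quotient_span_toLaurent {x : σ} (y : {l // l ≠ x}) {c : k} (hc : c ≠ 0)
    (r : MvPolynomial {l // l ≠ x} k) :
    Nonempty (Localization.Away (r * ∏ l, X l) ≃ₐ[k]
      AddMonoidAlgebra k (σ →₀ ℤ) ⧸
        Ideal.span {toLaurent σ k (C c * X x * X y.1 + rename Subtype.val r)}) := by
  set s := r * ∏ l, X l
  set f := C c * X x * X y.1 + rename Subtype.val r with hf
  set I := Ideal.span {toLaurent σ k f}
  let A := Localization.Away s
  let j : MvPolynomial {l // l ≠ x} k →ₐ[k] A := IsScalarTower.toAlgHom k _ A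
  have hs : IsUnit (j s) := IsLocalization.Away.algebraMap_isUnit s
  have hr : IsUnit (j r) := isUnit_of_dvd_unit (map_dvd j (dvd_mul_right _ _)) hs
  have hX (l) : IsUnit (j (X l)) := isUnit_of_dvd_unit
    (map_dvd j (dvd_mul_of_dvd_right (Finset.dvd_prod_of_mem _ (Finset.mem_univ l)) _)) hs
  have hcA : IsUnit (j (C c)) := (hc.isUnit.map C).map j
  let u (l : σ) : Aˣ :=
    if h : l = x then -hr.unit * (hcA.unit * (hX y).unit)⁻¹ else (hX ⟨l, h⟩).unit
  have hux : j (C c) * u x * j (X y) = - j r := by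
    have : hcA.unit * u x * (hX y).unit = -hr.unit := by
      simp only [u, dif_pos]
      rw [mul_right_comm, mul_comm, mul_assoc, inv_mul_cancel, mul_one]
    simpa using congrArg Units.val this
  have hul (l : {l // l ≠ x}) : (u l : A) = j (X l) := by
    simp [u, dif_neg l.2]
  have hur : aeval (fun l => (u l : A)) (rename Subtype.val r) = j r := by
    rw [aeval_rename]
    congr 1
    ext l
    simp [hul]
  have hjC : algebraMap k A c = j (C c) := (j.commutes c).symm
  let φ : (AddMonoidAlgebra k (σ →₀ ℤ) ⧸ I) →ₐ[k] A :=
    Ideal.Quotient.liftₐ I (laurentEval u) fun a ha => by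
      obtain ⟨b, rfl⟩ := Ideal.mem_span_singleton'.1 ha
      rw [map_mul, laurentEval_toLaurent, hf, map_add, map_mul, map_mul, aeval_X, aeval_X,
        hur, hul, aeval_C, hjC, hux, neg_add_cancel, mul_zero]
  let q : MvPolynomial σ k →ₐ[k] AddMonoidAlgebra k (σ →₀ ℤ) ⧸ I :=
    (Ideal.Quotient.mkₐ k I).comp (toLaurent σ k)
  have hqf : q f = 0 := Ideal.Quotient.eq_zero_iff_mem.2 (Ideal.mem_span_singleton_self _)
  have hqX (l) : IsUnit (q (X l)) := (isUnit_toLaurent_X l).map (Ideal.Quotient.mkₐ k I)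
  have hqC : IsUnit (q (C c)) := (hc.isUnit.map C).map q
  have hφq (l) : φ (q (X l)) = u l := by
    change laurentEval u (toLaurent σ k (X l)) = _
    rw [laurentEval_toLaurent, aeval_X]
  let p : MvPolynomial {l // l ≠ x} k →ₐ[k] AddMonoidAlgebra k (σ →₀ ℤ) ⧸ I :=
    q.comp (rename Subtype.val)
  have hpr : q (C c) * q (X x) * q (X y.1) = - p r := by
    rw [← map_mul, ← map_mul]
    exact eq_neg_of_add_eq_zero_left ((map_add q _ _).symm.trans hqf)
  have hpX (l) : p (X l) = q (X l.1) := by simp [p]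
  have hps : IsUnit (p s) := by
    rw [map_mul, map_prod, ← neg_neg (p r), ← hpr]
    refine (((hqC.mul (hqX _)).mul (hqX _)).neg).mul ?_
    simp only [hpX]
    exact IsUnit.prod_iff.2 fun l _ => hqX _
  let ψ : A →ₐ[k] AddMonoidAlgebra k (σ →₀ ℤ) ⧸ I := IsLocalization.Away.liftAlgHom s hps
  have hψ (a) : ψ (j a) = p a := IsLocalization.Away.lift_eq s hps a
  refine ⟨AlgEquiv.ofAlgHom ψ φ ?_ ?_⟩
  · refine Ideal.Quotient.algHom_ext _ (laurent_algHom_ext fun l => ?_)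
    change ψ (φ (q (X l))) = q (X l)
    rw [hφq]
    by_cases h : l = x
    · subst h
      have := congrArg ψ hux
      rw [map_mul, map_mul, map_neg, hψ, hψ, hψ, ← hpr, hpX] at this
      have hC : p (C c) = q (C c) := by simp [p]
      rw [hC] at this
      exact hqC.mul_left_cancel ((hqX _).mul_right_cancel this)
    · rw [hul ⟨l, h⟩, hψ, hpX]
  · refine IsLocalization.algHom_ext (Submonoid.powers s) ?_
    ext l
    change φ (ψ (j (X l))) = j (X l)
    rw [hψ, hpX, hφq, hul]

theorem smooth_and_isDomain_quotient_span_toLaurent {x : σ} (y : {l // l ≠ x}) {c : k}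
    (hc : c ≠ 0) {r : MvPolynomial {l // l ≠ x} k} (hr : r ≠ 0) {f : MvPolynomial σ k}
    (hf : f = C c * X x * X y.1 + rename Subtype.val r) :
    Algebra.Smooth k (AddMonoidAlgebra k (σ →₀ ℤ) ⧸ Ideal.span {toLaurent σ k f}) ∧
      IsDomain (AddMonoidAlgebra k (σ →₀ ℤ) ⧸ Ideal.span {toLaurent σ k f}) := by
  subst hf
  obtain ⟨e⟩ := exists_algEquiv_quotient_span_toLaurent y hc r
  set s := r * ∏ l, X l
  have hs : s ≠ 0 := mul_ne_zero hr (Finset.prod_ne_zero_iff.2 fun l _ => X_ne_zero l)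
  have : IsDomain (Localization.Away s) :=
    IsLocalization.isDomain_localization (powers_le_nonZeroDivisors_of_noZeroDivisors hs)
  have : Algebra.Smooth (MvPolynomial {l // l ≠ x} k) (Localization.Away s) :=
    .of_isLocalization_Away s
  have : Algebra.Smooth k (MvPolynomial {l // l ≠ x} k) := {}
  have : Algebra.Smooth k (Localization.Away s) :=
    .comp k (MvPolynomial {l // l ≠ x} k) _
  exact ⟨.of_equiv e, e.symm.toMulEquiv.isDomain _⟩

end Laurent

section Quadric

variable {σ ι k : Type} [Field k] {a b : ι → σ} {c : ι → k}

/-- The polynomial `∑ i ∈ T, c i * X (a i) * X (b i)`. -/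
noncomputable def quadric (a b : ι → σ) (c : ι → k) (T : Finset ι) : MvPolynomial σ k :=
  ∑ i ∈ T, C (c i) * X (a i) * X (b i)

theorem C_mul_X_mul_X (x y : σ) (e : k) :
    C e * X x * X y = monomial (Finsupp.single x 1 + Finsupp.single y 1) e := by
  rw [C_mul_X_eq_monomial, X, monomial_mul, mul_one]

theorem exists_of_mem_support_quadric {T : Finset ι} {d : σ →₀ ℕ}
    (hd : d ∈ (quadric a b c T).support) :
    ∃ i ∈ T, d = Finsupp.single (a i) 1 + Finsupp.single (b i) 1 := by
  obtain ⟨i, hi, hdi⟩ := Finset.mem_biUnion.1 (support_sum hd)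
  rw [C_mul_X_mul_X] at hdi
  exact ⟨i, hi, Finset.mem_singleton.1 (support_monomial_subset hdi)⟩

theorem quadric_ne_zero (ha : a.Injective) (hab : ∀ i j, a i ≠ b j) (hc : ∀ i, c i ≠ 0)
    {T : Finset ι} (hT : T.Nonempty) : quadric a b c T ≠ 0 := by
  obtain ⟨i, hi⟩ := hT
  intro h
  have hcoeff := congrArg (coeff (Finsupp.single (a i) 1 + Finsupp.single (b i) 1)) h
  rw [quadric, coeff_sum, Finset.sum_eq_single_of_mem i hi, C_mul_X_mul_X, coeff_monomial,
    if_pos rfl, coeff_zero] at hcoeff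
  · exact hc i hcoeff
  · intro j _ hji
    rw [C_mul_X_mul_X, coeff_monomial, if_neg]
    intro hd
    have := DFunLike.congr_fun hd (a i)
    simp [ha.eq_iff, hji, (hab _ _).symm] at this

theorem exists_initialForm_quadric [Fintype ι] [Nonempty ι] (w : σ → ℝ) (ha : a.Injective)
    (hab : ∀ i j, a i ≠ b j) (hc : ∀ i, c i ≠ 0) :
    ∃ T : Finset ι, T.Nonempty ∧
      initialForm w (quadric a b c Finset.univ) = quadric a b c T := by
  let wt (i : ι) := monWeight w (Finsupp.single (a i) 1 + Finsupp.single (b i) 1)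
  obtain ⟨i, -, hi⟩ := Finset.exists_min_image Finset.univ wt Finset.univ_nonempty
  set T := Finset.univ.filter fun j => wt j = wt i
  have hT : T.Nonempty := ⟨i, by simp [T]⟩
  have hsum : quadric a b c Finset.univ = quadric a b c T + quadric a b c Tᶜ :=
    (Finset.sum_add_sum_compl T _).symm
  refine ⟨T, hT, ?_⟩
  rw [hsum]
  refine initialForm_add w (m := wt i) (quadric_ne_zero ha hab hc hT) ?_ ?_
  · intro d hd
    obtain ⟨j, hj, rfl⟩ := exists_of_mem_support_quadric hd
    exact (Finset.mem_filter.1 hj).2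
  · intro d hd
    obtain ⟨j, hj, rfl⟩ := exists_of_mem_support_quadric hd
    refine lt_of_le_of_ne (hi j (Finset.mem_univ j)) fun h => ?_
    exact Finset.mem_compl.1 hj (Finset.mem_filter.2 ⟨Finset.mem_univ j, h.symm⟩)

/-- A proper quotient of the Laurent polynomial ring by a quadric in disjoint pairs of variables
is a smooth domain. -/
theorem smooth_and_isDomain_quotient_span_quadric [Fintype σ] (ha : a.Injective)
    (hab : ∀ i j, a i ≠ b j) (hc : ∀ i, c i ≠ 0) {T : Finset ι} (hT : T.Nonempty)
    (hproper : Ideal.span {toLaurent σ k (quadric a b c T)} ≠ ⊤) :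
    Algebra.Smooth k
        (AddMonoidAlgebra k (σ →₀ ℤ) ⧸ Ideal.span {toLaurent σ k (quadric a b c T)}) ∧
      IsDomain (AddMonoidAlgebra k (σ →₀ ℤ) ⧸ Ideal.span {toLaurent σ k (quadric a b c T)}) := by
  obtain ⟨i, hi⟩ := hT
  have hsplit : quadric a b c T = C (c i) * X (a i) * X (b i) + quadric a b c (T.erase i) :=
    (Finset.add_sum_erase T _ hi).symm
  rcases (T.erase i).eq_empty_or_nonempty with hE | hE
  · refine absurd (Ideal.span_singleton_eq_top.2 ?_) hproper
    rw [hsplit, hE, quadric, Finset.sum_empty, add_zero, map_mul, map_mul]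
    exact (((hc i).isUnit.map C).map (toLaurent σ k)).mul (isUnit_toLaurent_X _) |>.mul
      (isUnit_toLaurent_X _)
  let r : MvPolynomial {l // l ≠ a i} k :=
    ∑ j ∈ (T.erase i).attach,
      C (c j) * X ⟨a j, fun h => Finset.ne_of_mem_erase j.2 (ha h)⟩ * X ⟨b j, (hab i j).symm⟩
  have hr : rename Subtype.val r = quadric a b c (T.erase i) := by
    simp only [r, map_sum, map_mul, rename_C, rename_X]
    exact Finset.sum_attach (T.erase i) fun j => C (c j) * X (a j) * X (b j)
  refine smooth_and_isDomain_quotient_span_toLaurent (x := a i) ⟨b i, (hab i i).symm⟩ (hc i)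
    (r := r) ?_ (hr ▸ hsplit)
  intro h
  rw [h, map_zero] at hr
  exact quadric_ne_zero ha hab hc hE hr.symm

end Quadric

theorem exists_spinorQuartic_eq_quadric (k : Type) [Field k] :
    ∃ (a b : Fin 4 → E4) (c : Fin 4 → k), a.Injective ∧ (∀ i j, a i ≠ b j) ∧ (∀ i, c i ≠ 0) ∧
      spinorQuartic k = quadric a b c Finset.univ := by
  let a : Fin 4 → {l : Finset (Fin 4) // Even l.card} :=
    ![⟨∅, by decide⟩, ⟨{0, 1}, by decide⟩, ⟨{0, 2}, by decide⟩, ⟨{0, 3}, by decide⟩]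
  let b : Fin 4 → {l : Finset (Fin 4) // Even l.card} :=
    ![⟨{0, 1, 2, 3}, by decide⟩, ⟨{2, 3}, by decide⟩, ⟨{1, 3}, by decide⟩, ⟨{1, 2}, by decide⟩]
  have ha : ∀ i j, (a i).1 = (a j).1 → i = j := by decide
  have hab : ∀ i j, (a i).1 ≠ (b j).1 := by decide
  refine ⟨a, b, ![1, -1, 1, -1], fun i j h => ha i j (congrArg Subtype.val h),
    fun i j h => hab i j (congrArg Subtype.val h), fun i => by fin_cases i <;> simp, ?_⟩
  simp only [quadric, Fin.sum_univ_four, spinorQuartic]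
  simp [a, b]
  ring

theorem initial_degenerations_S4_smooth_irreducible (k : Type) [Field k]
    [IsAlgClosed k] [CharZero k] (w : E4 → ℝ)
    (hproper : Ideal.map (toLaurent4 k) (initialIdeal w (I4 k)) ≠ ⊤) :
    Algebra.Smooth k
      (Laurent4 k ⧸ Ideal.map (toLaurent4 k) (initialIdeal w (I4 k))) ∧
    IrreducibleSpace
      (PrimeSpectrum (Laurent4 k ⧸ Ideal.map (toLaurent4 k) (initialIdeal w (I4 k)))) := by
  obtain ⟨a, b, c, ha, hab, hc, hg⟩ := exists_spinorQuartic_eq_quadric k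
  obtain ⟨T, hT, hinit⟩ := exists_initialForm_quadric w ha hab hc
  have hI : Ideal.map (toLaurent4 k) (initialIdeal w (I4 k)) =
      Ideal.span {toLaurent E4 k (quadric a b c T)} := by
    rw [I4, hg, initialIdeal_span_singleton w (quadric_ne_zero ha hab hc Finset.univ_nonempty),
      hinit, Ideal.map_span, Set.image_singleton]
    rfl
  rw [hI] at hproper ⊢
  obtain ⟨hsmooth, hdom⟩ := smooth_and_isDomain_quotient_span_quadric ha hab hc hT hproper
  exact ⟨hsmooth, inferInstance⟩
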